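/- Let q ≥ 4 be a prime power. For the Veronese code C_q, the number of 5-dimensional subcodes of each weight is: A_{q^2+q}^(5) = q^2+q+1, A_{q^2+q+1}^(5) = q^5+q^4+q^3, and A_w^(5) = 0 for every other weight w. -/

import Mathlib

noncomputable section

open MvPolynomial

/-- The projective plane over `F`: the projectivization of `F^3`. -/
abbrev Plane (F : Type*) [Field F] := Projectivization F (Fin 3 → F)

/-- The Veronese code: evaluations of homogeneous degree-2 polynomials at the
chosen representatives of the points of the projective plane. -/
def VeroneseCode {F : Type*} [Field F] (rep : Plane F → (Fin 3 → F)) :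
    Submodule F (Plane F → F) :=
  (MvPolynomial.homogeneousSubmodule (Fin 3) F 2).map
    (LinearMap.pi fun p => (MvPolynomial.aeval (rep p)).toLinearMap)

/-- The (Hamming) weight of a word: the size of its support. -/
def wt {α K : Type*} [Zero K] (g : α → K) : ℕ := Nat.card {p | g p ≠ 0}

/-- The weight of a subcode: the size of the union of supports of its elements. -/
def wtSub {F α : Type*} [Field F] (D : Submodule F (α → F)) : ℕ :=
  Nat.card {p | ∃ c ∈ D, c p ≠ 0}

/-- The higher weight spectrum `A_w^(r)`: the number of subspaces of the Veronese
code of dimension `r` and weight `w`. -/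
def hwSpectrum {F : Type*} [Field F] (rep : Plane F → (Fin 3 → F)) (r w : ℕ) : ℕ :=
  Nat.card {D : Submodule F (Plane F → F) //
    D ≤ VeroneseCode rep ∧ Module.finrank F ↥D = r ∧ wtSub D = w}


/-- Evaluation map on all polynomials. -/
def evMap {F : Type*} [Field F] (rep : Plane F → (Fin 3 → F)) :
    MvPolynomial (Fin 3) F →ₗ[F] (Plane F → F) :=
  LinearMap.pi fun p => (MvPolynomial.aeval (rep p)).toLinearMap

lemma evMap_apply {F : Type*} [Field F] (rep : Plane F → (Fin 3 → F))
    (f : MvPolynomial (Fin 3) F) (p : Plane F) : evMap rep f p = MvPolynomial.eval (rep p) f := by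
  simp [evMap, MvPolynomial.aeval_eq_eval]

lemma finrank_homog (F : Type*) [Field F] :
    Module.finrank F (MvPolynomial.homogeneousSubmodule (Fin 3) F 2) = 6 := by
  classical
  have hspan : MvPolynomial.homogeneousSubmodule (Fin 3) F 2 =
      Submodule.span F (Set.range fun d : (Finset.univ : Finset (Fin 3)).finsuppAntidiag 2 =>
        MvPolynomial.basisMonomials (Fin 3) F d.1) := by
    apply le_antisymm
    · intro f hf
      rw [f.as_sum]
      refine Submodule.sum_mem _ fun d hd => ?_
      have hd2 : d ∈ (Finset.univ : Finset (Fin 3)).finsuppAntidiag 2 := by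
        have := (MvPolynomial.mem_homogeneousSubmodule 2 f).1 hf (MvPolynomial.mem_support_iff.1 hd)
        rw [Finset.mem_finsuppAntidiag]
        refine ⟨?_, Finset.subset_univ _⟩
        rw [← this, Finsupp.weight_apply, Finsupp.sum_fintype _ _ (by simp)]
        simp
      have : MvPolynomial.monomial d (f.coeff d) =
          f.coeff d • MvPolynomial.basisMonomials (Fin 3) F d := by
        simp [MvPolynomial.smul_monomial]
      rw [this]
      exact Submodule.smul_mem _ _ (Submodule.subset_span ⟨⟨d, hd2⟩, rfl⟩)
    · rw [Submodule.span_le]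
      rintro _ ⟨⟨d, hd⟩, rfl⟩
      simp only [MvPolynomial.coe_basisMonomials, SetLike.mem_coe,
        MvPolynomial.mem_homogeneousSubmodule]
      apply MvPolynomial.isHomogeneous_monomial
      rw [Finsupp.degree_eq_sum]
      exact (Finset.mem_finsuppAntidiag.1 hd).1
  rw [hspan, finrank_span_eq_card]
  · rw [Fintype.card_coe, Finset.card_finsuppAntidiag_nat_eq_choose]
    simp; decide
  · exact (MvPolynomial.basisMonomials (Fin 3) F).linearIndependent.comp _ Subtype.val_injective

lemma eval_smul_homog {F : Type*} [Field F] {f : MvPolynomial (Fin 3) F} {n : ℕ}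
    (hf : f.IsHomogeneous n) (a : F) (v : Fin 3 → F) :
    MvPolynomial.eval (a • v) f = a ^ n * MvPolynomial.eval v f := by
  rw [MvPolynomial.eval_eq', MvPolynomial.eval_eq', Finset.mul_sum]
  refine Finset.sum_congr rfl fun d hd => ?_
  have h := hf (MvPolynomial.mem_support_iff.1 hd)
  rw [Finsupp.weight_apply, Finsupp.sum_fintype _ _ (by simp)] at h
  simp only [Pi.one_apply, smul_eq_mul, mul_one] at h
  simp only [Pi.smul_apply, smul_eq_mul, mul_pow, Finset.prod_mul_distrib,
    Finset.prod_pow_eq_pow_sum, h]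
  ring

lemma finrank_code {F : Type*} [Field F] [Fintype F] (hq4 : 4 ≤ Fintype.card F)
    (rep : Plane F → (Fin 3 → F))
    (hrep : ∀ p : Plane F, ∃ h : rep p ≠ 0, Projectivization.mk F (rep p) h = p) :
    Module.finrank F (VeroneseCode rep) = 6 := by
  rw [← finrank_homog F]
  have hinj : Function.Injective
      ((evMap rep).domRestrict (MvPolynomial.homogeneousSubmodule (Fin 3) F 2)) := by
    rw [injective_iff_map_eq_zero]
    rintro ⟨f, hf⟩ h0
    have hf' := (MvPolynomial.mem_homogeneousSubmodule 2 f).1 hf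
    ext1
    refine hf'.eq_zero_of_forall_eval_eq_zero_of_le_card ?_ ?_
    · intro v
      by_cases hv : v = 0
      · subst hv
        rw [MvPolynomial.eval_zero, MvPolynomial.constantCoeff_eq]
        exact hf'.coeff_eq_zero (by simp)
      · obtain ⟨h, hp⟩ := hrep (Projectivization.mk F v hv)
        obtain ⟨a, ha⟩ := (Projectivization.mk_eq_mk_iff' F _ _ hv h).1 hp.symm
        have h1 := congrFun h0 (Projectivization.mk F v hv)
        rw [LinearMap.domRestrict_apply, evMap_apply] at h1
        rw [← ha, eval_smul_homog hf']
        simp [h1]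
    · rw [Cardinal.mk_fintype]
      exact_mod_cast (by omega : 2 ≤ Fintype.card F)
  rw [← LinearMap.finrank_range_of_inj hinj, LinearMap.range_domRestrict]
  rfl

lemma exists_sep {F : Type*} [Field F] (rep : Plane F → (Fin 3 → F))
    (hrep : ∀ p : Plane F, ∃ h : rep p ≠ 0, Projectivization.mk F (rep p) h = p)
    (W : Submodule F (Fin 3 → F)) (p : Plane F) (hp : rep p ∉ W) :
    ∃ c ∈ VeroneseCode rep, c p ≠ 0 ∧ ∀ p', rep p' ∈ W → c p' = 0 := by
  obtain ⟨l, hl, hW⟩ := Submodule.exists_le_ker_of_notMem hp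
  set L : MvPolynomial (Fin 3) F := ∑ i, MvPolynomial.C (l (Pi.single i 1)) * MvPolynomial.X i
  have hL : L.IsHomogeneous 1 := by
    apply MvPolynomial.IsHomogeneous.sum
    intro i _
    simpa using (MvPolynomial.isHomogeneous_C (Fin 3) (l (Pi.single i 1))).mul
      (MvPolynomial.isHomogeneous_X F i)
  have hev : ∀ v, MvPolynomial.eval v L = l v := by
    intro v
    conv_rhs => rw [pi_eq_sum_univ' v]
    simp only [L, map_sum, map_mul, MvPolynomial.eval_C, MvPolynomial.eval_X, map_smul,
      smul_eq_mul, mul_comm]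
  refine ⟨evMap rep (L ^ 2), Submodule.mem_map_of_mem (by simpa using hL.pow 2), ?_, ?_⟩
  · rw [evMap_apply, map_pow, hev]; exact pow_ne_zero _ hl
  · intro p' hp'
    rw [evMap_apply, map_pow, hev, hW hp']; simp

lemma card_hyper (F V : Type*) [Field F] [Finite F] [AddCommGroup V] [Module F V]
    [FiniteDimensional F V] (n : ℕ) (hV : Module.finrank F V = n + 1) :
    Nat.card {D : Submodule F V // Module.finrank F D = n} =
      ∑ i ∈ Finset.range (n + 1), Nat.card F ^ i := by
  rw [← Projectivization.card_of_finrank F (Module.Dual F V)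
    (by rw [Subspace.dual_finrank_eq, hV])]
  apply Nat.card_congr
  refine Equiv.trans ?_ (Projectivization.equivSubmodule F (Module.Dual F V)).symm
  refine Equiv.subtypeEquiv
    (Subspace.orderIsoFiniteDimensional.toEquiv.trans OrderDual.ofDual) ?_
  intro D
  have := Subspace.finrank_add_finrank_dualAnnihilator_eq D
  change _ ↔ Module.finrank F (Submodule.dualAnnihilator D) = 1
  omega

lemma card_hyper' {F V : Type*} [Field F] [Finite F] [AddCommGroup V] [Module F V]
    (C : Submodule F V) [FiniteDimensional F C] (n : ℕ) (hV : Module.finrank F C = n + 1) :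
    {D : Submodule F V | D ≤ C ∧ Module.finrank F D = n}.ncard =
      ∑ i ∈ Finset.range (n + 1), Nat.card F ^ i := by
  rw [← card_hyper F C n hV, ← Nat.card_coe_set_eq]
  apply Nat.card_congr
  refine Equiv.symm (Equiv.ofBijective (fun D => ⟨D.1.map C.subtype,
    Submodule.map_subtype_le _ _, by rw [Submodule.finrank_map_subtype_eq]; exact D.2⟩) ⟨?_, ?_⟩)
  · rintro ⟨D, hD⟩ ⟨E, hE⟩ h
    simp only [Subtype.mk.injEq] at h ⊢
    exact Submodule.map_injective_of_injective C.injective_subtype h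
  · rintro ⟨D, hD, hD'⟩
    have h := Submodule.map_comap_subtype C D
    rw [inf_eq_right.2 hD] at h
    refine ⟨⟨D.comap C.subtype, ?_⟩, ?_⟩
    · rw [← Submodule.finrank_map_subtype_eq, h, hD']
    · simp only [Subtype.mk.injEq]; exact h

theorem veronese_spectrum_dim_five
    {F : Type*} [Field F] [Fintype F] (q : ℕ) (hq : Fintype.card F = q) (hq4 : 4 ≤ q)
    (rep : Plane F → (Fin 3 → F))
    (hrep : ∀ p : Plane F, ∃ h : rep p ≠ 0, Projectivization.mk F (rep p) h = p) :
    hwSpectrum rep 5 (q ^ 2 + q) = q ^ 2 + q + 1 ∧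
    hwSpectrum rep 5 (q ^ 2 + q + 1) = q ^ 5 + q ^ 4 + q ^ 3 ∧
    ∀ w : ℕ, w ∉ ({q ^ 2 + q, q ^ 2 + q + 1} : Set ℕ) → hwSpectrum rep 5 w = 0 := by
  classical
  have hC := finrank_code (hq ▸ hq4) rep hrep
  have hcF : Nat.card F = q := by rw [Nat.card_eq_fintype_card, hq]
  have hcP : Nat.card (Plane F) = q ^ 2 + q + 1 := by
    rw [Projectivization.card_of_finrank F (Fin 3 → F) (n := 3) (by simp), hcF]
    simp [Finset.sum_range_succ]; ring
  have hS := card_hyper' (VeroneseCode rep) 5 hC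
  rw [hcF] at hS
  set S := {D : Submodule F (Plane F → F) | D ≤ VeroneseCode rep ∧ Module.finrank F D = 5}
    with hSdef
  -- the hyperplane of words vanishing at a point
  let H : Plane F → Submodule F (Plane F → F) := fun p =>
    VeroneseCode rep ⊓ LinearMap.ker (LinearMap.proj (R := F) (φ := fun _ : Plane F => F) p)
  have hHr : ∀ p, Module.finrank F (H p) = 5 := by
    intro p
    obtain ⟨c, hc, hcp, -⟩ := exists_sep rep hrep ⊥ p (by simpa using (hrep p).1)
    let φ : Module.Dual F (VeroneseCode rep) :=
      (LinearMap.proj (R := F) (φ := fun _ : Plane F => F) p).comp (VeroneseCode rep).subtype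
    have hφ : φ ≠ 0 := by
      intro h
      exact hcp (LinearMap.congr_fun h ⟨c, hc⟩)
    have h1 := Module.Dual.finrank_ker_add_one_of_ne_zero hφ
    have h2 : H p = (LinearMap.ker φ).map (VeroneseCode rep).subtype := by
      rw [LinearMap.ker_comp, Submodule.map_comap_subtype]
    rw [h2, Submodule.finrank_map_subtype_eq]
    omega
  have hHS : ∀ p, H p ∈ S := fun p => ⟨inf_le_left, hHr p⟩
  have hHinj : Function.Injective H := by
    intro p p' h
    by_contra hne
    obtain ⟨c, hc, hcp, hc0⟩ := exists_sep rep hrep (Submodule.span F {rep p'}) p (by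
      intro hmem
      obtain ⟨a, ha⟩ := Submodule.mem_span_singleton.1 hmem
      apply hne
      obtain ⟨h1, h2⟩ := hrep p
      obtain ⟨h3, h4⟩ := hrep p'
      rw [← h2, ← h4]
      exact (Projectivization.mk_eq_mk_iff' F _ _ h1 h3).2 ⟨a, ha⟩)
    have : c ∈ H p' := ⟨hc, hc0 p' (Submodule.mem_span_singleton_self _)⟩
    rw [← h] at this
    exact hcp this.2
  have hZ : ∀ D ∈ S, wtSub D + {p | H p = D}.ncard = q ^ 2 + q + 1 := by
    rintro D ⟨hD, hD5⟩
    have : {p | H p = D} = {p | ∃ c ∈ D, c p ≠ 0}ᶜ := by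
      ext p
      simp only [Set.mem_ofPred_eq, Set.mem_compl_iff, not_exists, not_and, not_not]
      constructor
      · rintro rfl c hc
        exact hc.2
      · intro h
        have hle : D ≤ H p := fun c hc => ⟨hD hc, h c hc⟩
        exact (Submodule.eq_of_le_of_finrank_eq hle (by rw [hD5, hHr])).symm
    rw [this, wtSub, Nat.card_coe_set_eq, Set.ncard_add_ncard_compl, hcP]
  have hw1 : ∀ D ∈ S, D ∈ Set.range H → wtSub D = q ^ 2 + q := by
    rintro D hD ⟨p, rfl⟩
    have h1 := hZ _ hD
    have : {p' | H p' = H p} = {p} := by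
      ext p'; simp [hHinj.eq_iff]
    rw [this, Set.ncard_singleton] at h1
    omega
  have hw2 : ∀ D ∈ S, D ∉ Set.range H → wtSub D = q ^ 2 + q + 1 := by
    intro D hD hn
    have h1 := hZ _ hD
    have : {p' | H p' = D} = ∅ := by
      ext p'; simp only [Set.mem_ofPred_eq, Set.mem_empty_iff_false, iff_false]
      exact fun h => hn ⟨p', h⟩
    rw [this, Set.ncard_empty] at h1
    omega
  have hspec : ∀ w, hwSpectrum rep 5 w = {D | D ∈ S ∧ wtSub D = w}.ncard := by
    intro w
    rw [hwSpectrum, ← Nat.card_coe_set_eq]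
    simp only [hSdef, Set.mem_ofPred_eq, and_assoc]
    rfl
  have hsub : Set.range H ⊆ S := by rintro _ ⟨p, rfl⟩; exact hHS p
  have hrange : (Set.range H).ncard = q ^ 2 + q + 1 := by
    rw [← hcP, ← Set.image_univ, Set.ncard_image_of_injective _ hHinj, Set.ncard_univ]
  refine ⟨?_, ?_, ?_⟩
  · rw [hspec, ← hrange]
    congr 1
    ext D
    constructor
    · rintro ⟨hD, hw⟩
      by_contra hn
      have := hw2 D hD hn
      omega
    · intro h
      exact ⟨hsub h, hw1 D (hsub h) h⟩
  · have : {D | D ∈ S ∧ wtSub D = q ^ 2 + q + 1} = S \ Set.range H := by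
      ext D
      constructor
      · rintro ⟨hD, hw⟩
        refine ⟨hD, fun h => ?_⟩
        have := hw1 D hD h
        omega
      · rintro ⟨hD, hn⟩
        exact ⟨hD, hw2 D hD hn⟩
    rw [hspec, this, Set.ncard_sdiff hsub (Set.toFinite _), hS, hrange]
    simp only [Finset.sum_range_succ, Finset.sum_range_zero]
    apply Nat.sub_eq_of_eq_add
    ring
  · intro w hw
    simp only [Set.mem_insert_iff, Set.mem_singleton_iff, not_or] at hw
    rw [hspec]
    have : {D | D ∈ S ∧ wtSub D = w} = ∅ := by
      ext D
      simp only [Set.mem_ofPred_eq, Set.mem_empty_iff_false, iff_false, not_and]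
      intro hD h
      by_cases hr : D ∈ Set.range H
      · exact hw.1 (h ▸ hw1 D hD hr)
      · exact hw.2 (h ▸ hw2 D hD hr)
    rw [this, Set.ncard_empty]
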